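/- Let (X,d) be a flat Robinson space with |X| ≥ 2, i.e., a Robinson space having exactly two compatible orders, a total order < and its opposite. Then either every mmodule of (X,d) is trivial, or there exists a unique point p ∈ X such that: p is non-diametral (d(p,x) < diam(X) for all x ∈ X), there is a constant δ with d(p,x) = δ for all x ∈ X \ {p}, and every mmodule of the subspace (X \ {p}, d) is trivial. -/

import Mathlib

/-- `M` is an mmodule of the subspace `(Y, d|_Y)`. -/
def IsMmoduleOn {X : Type*} (d : X → X → ℝ) (Y M : Set X) : Prop :=
  ∀ z ∈ Y \ M, ∀ x ∈ M, ∀ y ∈ M, d z x = d z y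

def IsCompatible {X : Type*} (d : X → X → ℝ) (lt : X → X → Prop) : Prop :=
  ∀ x y z : X, lt x y → lt y z → max (d x y) (d y z) ≤ d x z

/-- The distance of a flat Robinson space, with the linear order of `X` as compatible order. -/
structure IsFlatRobinson {X : Type*} [LinearOrder X] (d : X → X → ℝ) : Prop where
  symm : ∀ x y : X, d x y = d y x
  left_le : ∀ {x y z : X}, x ≤ y → y ≤ z → d x y ≤ d x z
  right_le : ∀ {x y z : X}, x ≤ y → y ≤ z → d y z ≤ d x z
  flat : ∀ lt' : X → X → Prop, IsStrictTotalOrder X lt' → IsCompatible d lt' →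
    (∀ x y, lt' x y ↔ x < y) ∨ (∀ x y, lt' x y ↔ y < x)

namespace IsFlatRobinson

variable {X : Type*} [LinearOrder X] {d : X → X → ℝ} {M : Set X}

/-- Reversing the order on a convex mmodule preserves compatibility, so in a flat space convex
mmodules are trivial. -/
theorem eq_univ_of_ordConnected (h : IsFlatRobinson d) (hM : IsMmoduleOn d Set.univ M)
    (hc : M.OrdConnected) (hn : M.Nontrivial) : M = Set.univ := by
  by_contra hu
  obtain ⟨w, hw⟩ := (Set.ne_univ_iff_exists_notMem M).1 hu
  obtain ⟨a, ha, b, hb, hab⟩ := hn.exists_lt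
  have hM' : ∀ z ∉ M, ∀ x ∈ M, ∀ y ∈ M, d z x = d z y := fun z hz => hM z ⟨trivial, hz⟩
  have hc' : ∀ x ∈ M, ∀ y ∈ M, ∀ z, x < z → z < y → z ∈ M :=
    fun x hx y hy z h1 h2 => hc.out hx hy ⟨h1.le, h2.le⟩
  have hsymm := h.symm
  have hl : ∀ x y z : X, x < y → y < z → d x y ≤ d x z :=
    fun x y z h1 h2 => h.left_le h1.le h2.le
  have hr : ∀ x y z : X, x < y → y < z → d y z ≤ d x z :=
    fun x y z h1 h2 => h.right_le h1.le h2.le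
  let r : X → X → Prop := fun x y => (x ∈ M ∧ y ∈ M ∧ y < x) ∨ (¬ (x ∈ M ∧ y ∈ M) ∧ x < y)
  have hsto : IsStrictTotalOrder X r :=
    { irrefl := by intro x; simp [r]
      trans := by intro x y z; simp only [r]; grind
      trichotomous := by intro x y; simp only [r]; grind }
  have hcomp : IsCompatible d r := by
    intro x y z
    simp only [r, max_le_iff]
    intro h1 h2
    by_cases hx : x ∈ M <;> by_cases hy : y ∈ M <;> by_cases hz : z ∈ M <;>
      simp only [hx, hy, hz, true_and, and_true, false_and, and_false, not_true_eq_false,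
        not_false_eq_true, or_false, false_or] at h1 h2 <;> grind
  rcases h.flat r hsto hcomp with h1 | h1
  · have := (h1 a b).2 hab
    simp only [r] at this
    grind
  · have h2 := h1 a w
    have h3 : a ≠ w := fun e => hw (e ▸ ha)
    simp only [r] at h2
    grind

theorem exists_bounds [Finite X] (h : IsFlatRobinson d) (hM : IsMmoduleOn d Set.univ M)
    (hn : M.Nontrivial) : ∃ a ∈ M, ∃ b ∈ M, ∀ x, a ≤ x ∧ x ≤ b := by
  obtain ⟨a, ha, ha'⟩ := Set.exists_min_image M id M.toFinite hn.nonempty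
  obtain ⟨b, hb, hb'⟩ := Set.exists_max_image M id M.toFinite hn.nonempty
  have hsub : M ⊆ Set.Icc a b := fun x hx => ⟨ha' x hx, hb' x hx⟩
  have key : IsMmoduleOn d Set.univ (Set.Icc a b) := by
    rintro z ⟨-, hz⟩
    have hzM : z ∉ M := fun hm => hz (hsub hm)
    have hab : d z a = d z b := hM z ⟨trivial, hzM⟩ a ha b hb
    have hconst : ∀ x ∈ Set.Icc a b, d z x = d z a := by
      rintro x ⟨h1, h2⟩
      rcases lt_or_ge z a with hza | hza
      · have := h.left_le hza.le h1
        have := h.left_le (hza.le.trans h1) h2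
        linarith
      · have hbz : b ≤ z := le_of_not_ge fun hzb => hz ⟨hza, hzb⟩
        have e1 := h.right_le h1 (h2.trans hbz)
        have e2 := h.right_le h2 hbz
        rw [h.symm z x, h.symm z a]
        rw [h.symm z a, h.symm z b] at hab
        linarith
    intro x hx y hy
    rw [hconst x hx, hconst y hy]
  have hu := h.eq_univ_of_ordConnected key Set.ordConnected_Icc (hn.mono hsub)
  exact ⟨a, ha, b, hb, fun x => Set.mem_Icc.1 (hu.symm ▸ Set.mem_univ x)⟩

/-- A nontrivial mmodule of a flat space is at constant distance from its complement, which is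
a single point. -/
theorem exists_eq_compl_singleton [Finite X] (h : IsFlatRobinson d)
    (hM : IsMmoduleOn d Set.univ M) (hn : M.Nontrivial) (hu : M ≠ Set.univ) :
    ∃ p, M = {p}ᶜ ∧ ∃ δ, ∀ x, x ≠ p → d p x = δ := by
  obtain ⟨a, ha, b, hb, hbd⟩ := h.exists_bounds hM hn
  have hM' : ∀ z ∉ M, ∀ x ∈ M, ∀ y ∈ M, d z x = d z y := fun z hz => hM z ⟨trivial, hz⟩
  have hle : ∀ z ∉ M, ∀ z' ∉ M, z ≤ z' → d z a = d z' a := by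
    intro z hz z' hz' hzz
    have e1 := h.left_le (hbd z).1 hzz
    have e2 := h.right_le hzz (hbd z').2
    have e3 := hM' z hz a ha b hb
    have e4 := hM' z' hz' a ha b hb
    rw [h.symm a z, h.symm a z'] at e1
    linarith
  have hconst : ∀ z ∉ M, ∀ z' ∉ M, d z a = d z' a := fun z hz z' hz' =>
    (le_total z z').elim (hle z hz z' hz') fun e => (hle z' hz' z hz e).symm
  have hC : IsMmoduleOn d Set.univ Mᶜ := by
    rintro m ⟨-, hm⟩ x hx y hy
    rw [Set.notMem_compl_iff] at hm
    rw [h.symm m x, h.symm m y, hM' x hx m hm a ha, hM' y hy m hm a ha]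
    exact hconst x hx y hy
  obtain ⟨p, hp⟩ := (Set.ne_univ_iff_exists_notMem M).1 hu
  have hsub : Mᶜ.Subsingleton := by
    rw [← Set.not_nontrivial_iff]
    intro hcn
    obtain ⟨a', ha', _, _, hbd'⟩ := h.exists_bounds hC hcn
    exact ha' (le_antisymm (hbd' a).1 (hbd a').1 ▸ ha)
  have hMp : Mᶜ = {p} := hsub.eq_singleton_of_mem hp
  have hMp' : M = {p}ᶜ := by rw [← hMp, compl_compl]
  exact ⟨p, hMp', d p a, fun x hx => hM' p hp x (by rw [hMp']; exact hx) a ha⟩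

/-- A point at constant distance from the others that is not extremal is non-diametral. -/
theorem lt_of_const (h : IsFlatRobinson d) {p a b : X} {δ : ℝ}
    (hδ : ∀ x, x ≠ p → d p x = δ) (hap : a < p) (hpb : p < b)
    (hbd : ∀ x, a ≤ x ∧ x ≤ b) : δ < d a b := by
  by_contra! hle
  have hsymm := h.symm
  have hmax : ∀ x y, d x y ≤ δ := by
    have aux : ∀ x y, x ≤ y → d x y ≤ δ := fun x y hxy =>
      ((h.right_le (hbd x).1 hxy).trans (h.left_le (hbd y).1 (hbd y).2)).trans hle
    intro x y
    rcases le_total x y with e | e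
    · exact aux x y e
    · rw [hsymm]; exact aux y x e
  have hl : ∀ x y z : X, x < y → y < z → d x y ≤ d x z :=
    fun x y z h1 h2 => h.left_le h1.le h2.le
  have hr : ∀ x y z : X, x < y → y < z → d y z ≤ d x z :=
    fun x y z h1 h2 => h.right_le h1.le h2.le
  let r : X → X → Prop := fun x y => y ≠ p ∧ (x = p ∨ x < y)
  have hsto : IsStrictTotalOrder X r :=
    { irrefl := by intro x; simp only [r]; grind
      trans := by intro x y z; simp only [r]; grind
      trichotomous := by intro x y; simp only [r]; grind }
  have hcomp : IsCompatible d r := by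
    intro x y z
    simp only [r, max_le_iff]
    grind
  rcases h.flat r hsto hcomp with h1 | h1
  · have := h1 p a
    simp only [r] at this
    grind
  · have := h1 p b
    simp only [r] at this
    grind

end IsFlatRobinson

theorem le_iSup_iSup_of_finite {X : Type*} [Finite X] (d : X → X → ℝ) (a b : X) :
    d a b ≤ ⨆ y : X, ⨆ z : X, d y z :=
  (le_ciSup (Set.finite_range (d a)).bddAbove b).trans
    (le_ciSup (f := fun y => ⨆ z, d y z) (Set.finite_range _).bddAbove a)

theorem Set.trivial_of_not_nontrivial {X : Type*} {M : Set X} (h : ¬ M.Nontrivial) :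
    M = ∅ ∨ ∃ x : X, M = {x} :=
  (Set.not_nontrivial_iff.1 h).eq_empty_or_singleton

/-- in a flat Robinson space (exactly two compatible orders: `lt` and
its opposite) with at least two points, either all mmodules are trivial, or there is
a unique point `p` which is non-diametral, at constant distance `δ` from all other
points, and such that all mmodules of the subspace `X \ {p}` are trivial. -/
theorem flat_robinson_mmodules {X : Type*} [Fintype X] (d : X → X → ℝ)
    (hsymm : ∀ x y : X, d x y = d y x)
    (hnonneg : ∀ x y : X, 0 ≤ d x y)
    (hself : ∀ x : X, d x x = 0)
    (hcard : 2 ≤ Fintype.card X)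
    (lt : X → X → Prop) (hsto : IsStrictTotalOrder X lt)
    (hcomp : IsCompatible d lt)
    (hflat : ∀ lt' : X → X → Prop, IsStrictTotalOrder X lt' → IsCompatible d lt' →
      lt' = lt ∨ lt' = fun x y => lt y x) :
    (∀ M : Set X, IsMmoduleOn d Set.univ M →
      M = ∅ ∨ M = Set.univ ∨ ∃ x : X, M = {x}) ∨
    (∃! p : X,
      (∀ x : X, d p x < ⨆ y : X, ⨆ z : X, d y z) ∧
      (∃ δ : ℝ, ∀ x : X, x ≠ p → d p x = δ) ∧
      (∀ M : Set X, M ⊆ {p}ᶜ → IsMmoduleOn d {p}ᶜ M →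
        M = ∅ ∨ M = {p}ᶜ ∨ ∃ x : X, M = {x})) := by
  classical
  let _ : LinearOrder X := linearOrderOfSTO lt
  have h : IsFlatRobinson d :=
    { symm := hsymm
      left_le := by
        intro x y z h1 h2
        rcases h1.eq_or_lt with rfl | h1
        · rw [hself]; exact hnonneg _ _
        rcases h2.eq_or_lt with rfl | h2
        · exact le_rfl
        exact (le_max_left _ _).trans (hcomp x y z h1 h2)
      right_le := by
        intro x y z h1 h2
        rcases h2.eq_or_lt with rfl | h2
        · rw [hself]; exact hnonneg _ _
        rcases h1.eq_or_lt with rfl | h1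
        · exact le_rfl
        exact (le_max_right _ _).trans (hcomp x y z h1 h2)
      flat := by
        intro r hr hc
        rcases hflat r hr hc with e | e
        · exact .inl fun x y => iff_of_eq (congrFun (congrFun e x) y)
        · exact .inr fun x y => iff_of_eq (congrFun (congrFun e x) y) }
  rw [or_iff_not_imp_left]
  intro hnot
  push Not at hnot
  obtain ⟨M, hM, hne, hu, hns⟩ := hnot
  have hn : M.Nontrivial := by
    by_contra hn
    rcases Set.trivial_of_not_nontrivial hn with e | ⟨x, e⟩
    · exact hne.ne_empty e
    · exact hns x e
  obtain ⟨p, hMp, δ, hδ⟩ := h.exists_eq_compl_singleton hM hn hu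
  obtain ⟨a, ha, b, hb, hbd⟩ := h.exists_bounds hM hn
  have hap : a ≠ p := by rw [hMp] at ha; exact ha
  have hbp : b ≠ p := by rw [hMp] at hb; exact hb
  have hap' : a < p := lt_of_le_of_ne (hbd p).1 hap
  have hpb' : p < b := lt_of_le_of_ne (hbd p).2 hbp.symm
  have hlt : δ < d a b := h.lt_of_const hδ hap' hpb' hbd
  have hsup := le_iSup_iSup_of_finite d a b
  refine ⟨p, ⟨fun x => ?_, ⟨δ, hδ⟩, fun N hN hNm => ?_⟩, ?_⟩
  · by_cases hx : x = p
    · have := hδ a hap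
      have := hnonneg p a
      rw [hx, hself]
      linarith
    · rw [hδ x hx]
      linarith
  · by_cases hNn : N.Nontrivial
    · have hNX : IsMmoduleOn d Set.univ N := by
        rintro z ⟨-, hz⟩ x hx y hy
        by_cases hzp : z = p
        · rw [hzp, hδ x (hN hx), hδ y (hN hy)]
        · exact hNm z ⟨hzp, hz⟩ x hx y hy
      have hNu : N ≠ Set.univ := fun e => hN (e.symm ▸ Set.mem_univ p) rfl
      obtain ⟨q, hq, -⟩ := h.exists_eq_compl_singleton hNX hNn hNu
      have hpq : p = q := by
        by_contra hpq
        exact hN (hq.symm ▸ hpq : p ∈ N) rfl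
      exact .inr (.inl (hpq ▸ hq))
    · rcases Set.trivial_of_not_nontrivial hNn with e | e
      · exact .inl e
      · exact .inr (.inr e)
  · rintro q ⟨hq, ⟨δ', hδ'⟩, -⟩
    by_contra hqp
    have hpq : IsMmoduleOn d Set.univ {p, q} := by
      rintro z ⟨-, hz⟩
      simp only [Set.mem_insert_iff, Set.mem_singleton_iff, not_or] at hz
      have e1 := hδ z hz.1
      have e2 := hδ' z hz.2
      have e3 := hδ q hqp
      have e4 := hδ' p (Ne.symm hqp)
      have e5 := hsymm p q
      have e6 : d z p = d z q := by rw [hsymm z p, hsymm z q]; linarith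
      rintro x (rfl | rfl) y (rfl | rfl) <;> simp [e6]
    obtain ⟨a', ha', b', hb', hbd'⟩ :=
      h.exists_bounds hpq (Set.nontrivial_pair (Ne.symm hqp))
    have haa : a' = a := le_antisymm (hbd' a).1 (hbd a').1
    have hbb : b' = b := le_antisymm (hbd b').2 (hbd' b).2
    subst haa hbb
    have hab : a' = b' := (ha'.resolve_left hap).trans (hb'.resolve_left hbp).symm
    exact (hap'.trans hpb').ne hab
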